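/- arXiv:0902.2323 — 2 statements merged into one kernel-verified Lean document; each statement's English description precedes it below -/
import Mathlib

section
/- Let L be a bounded distributive lattice and let f : L^n → L be an associative lattice polynomial function. Then f can be written as f(x) = med(a, (b ∧ x_1) ∨ med(⋀_{i=1}^n x_i, b ∧ c, ⋁_{i=1}^n x_i) ∨ (c ∧ x_n), d), where a = f(0,…,0), b = f(1,0,…,0), c = f(0,…,0,1), d = f(1,…,1), and med(u,v,w) = (u ∨ v) ∧ (u ∨ w) ∧ (v ∨ w). -/
variable {X : Type*}

/-- The string consisting of the single letter `g y` if `y` is nonempty, and the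
empty string if `y` is empty (the convention `g ε = ε`). -/
def strOf (g : List X → X) (y : List X) : List X :=
  match y with
  | [] => []
  | _ => [g y]

/-- Associativity for functions on strings. -/
def AssocStar (g : List X → X) : Prop :=
  ∀ x y z x' y' z' : List X, x ++ y ++ z = x' ++ y' ++ z' →
    g (x ++ strOf g y ++ z) = g (x' ++ strOf g y' ++ z')

/-- Range-idempotency for functions on strings. -/
def RangeIdem (g : List X → X) : Prop :=
  ∀ x : List X, x ≠ [] → ∀ n : ℕ, 1 ≤ n → g (List.replicate n (g x)) = g x

/-- Application of an `n`-ary function to a list of length `n`. -/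
def liftF {n : ℕ} (f : (Fin n → X) → X) (l : List X) (h : l.length = n) : X :=
  f fun i => l.get (Fin.cast h.symm i)

/-- Associativity for `n`-ary functions. -/
def AssocFin {n : ℕ} (f : (Fin n → X) → X) : Prop :=
  ∀ (x z x' z' y y' : List X) (hy : y.length = n) (hy' : y'.length = n),
    x.length + z.length = n - 1 → x'.length + z'.length = n - 1 →
    x ++ y ++ z = x' ++ y' ++ z' →
    ∀ (h : (x ++ [liftF f y hy] ++ z).length = n)
      (h' : (x' ++ [liftF f y' hy'] ++ z').length = n),
      liftF f (x ++ [liftF f y hy] ++ z) h = liftF f (x' ++ [liftF f y' hy'] ++ z') h'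

variable {L : Type*} [DistribLattice L] [BoundedOrder L]

/-- Lattice polynomial functions: representable in disjunctive normal form. -/
def IsPolynomialFn {n : ℕ} (f : (Fin n → L) → L) : Prop :=
  ∃ α : Finset (Fin n) → L,
    ∀ x : Fin n → L, f x = Finset.univ.sup fun I : Finset (Fin n) => α I ⊓ I.inf x

/-- The ternary median. -/
def med (a b c : L) : L := (a ⊔ b) ⊓ (a ⊔ c) ⊓ (b ⊔ c)

/-- The characteristic vector of `I ⊆ [n]`. -/
def charVec {n : ℕ} (I : Finset (Fin n)) : Fin n → L := fun i => if i ∈ I then ⊤ else ⊥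

/-- A function on strings all of whose `n`-ary components (`n ≥ 1`) are polynomial. -/
def IsPolyStar (g : List L → L) : Prop :=
  ∀ n : ℕ, 1 ≤ n → IsPolynomialFn fun x : Fin n → L => g (List.ofFn x)

theorem Order.Ideal.IsPrime.inf_mem_iff {M : Type*} [SemilatticeInf M] {P : Order.Ideal M}
    (hP : P.IsPrime) {s t : M} : s ⊓ t ∈ P ↔ s ∈ P ∨ t ∈ P :=
  ⟨hP.mem_or_mem, fun h => h.elim (P.lower inf_le_left) (P.lower inf_le_right)⟩

theorem Order.Ideal.IsPrime.finset_inf_mem_iff {ι : Type*} {P : Order.Ideal L} (hP : P.IsPrime)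
    {s : Finset ι} {z : ι → L} : s.inf z ∈ P ↔ ∃ i ∈ s, z i ∈ P := by
  classical
  induction s using Finset.induction_on with
  | empty => simpa using hP.toIsProper.top_notMem
  | insert i s _ ih => simp [Finset.inf_insert, ih, hP.inf_mem_iff]

theorem Order.Ideal.finset_sup_mem_iff {ι : Type*} (P : Order.Ideal L) {s : Finset ι}
    {z : ι → L} : s.sup z ∈ P ↔ ∀ i ∈ s, z i ∈ P := by
  classical
  induction s using Finset.induction_on with
  | empty => simp
  | insert i s _ ih => simp [Finset.sup_insert, ih]

theorem DistribLattice.eq_of_forall_isPrime_mem_iff {M : Type*} [DistribLattice M]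
    {u v : M} (h : ∀ P : Order.Ideal M, P.IsPrime → (u ∈ P ↔ v ∈ P)) : u = v := by
  have key : ∀ s t : M, (∀ P : Order.Ideal M, P.IsPrime → (s ∈ P ↔ t ∈ P)) → s ≤ t := by
    intro s t hst
    by_contra hle
    have hdis : Disjoint ((Order.PFilter.principal s : Order.PFilter M) : Set M)
        ((Order.Ideal.principal t : Order.Ideal M) : Set M) := by
      rw [Set.disjoint_left]
      intro w hw hw'
      exact hle (le_trans (Order.PFilter.mem_principal.1 hw) (Order.Ideal.mem_principal.1 hw'))
    obtain ⟨P, hP, htP, hsP⟩ := DistribLattice.prime_ideal_of_disjoint_filter_ideal hdis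
    have ht : t ∈ P := htP (Order.Ideal.mem_principal.2 le_rfl)
    exact Set.disjoint_left.1 hsP (Order.PFilter.mem_principal.2 le_rfl) ((hst P hP).2 ht)
  exact le_antisymm (key u v h) (key v u fun P hP => (h P hP).symm)

/-- Associativity, read on a sequence `w`: contracting the window of length `n` that starts at
position `i` gives a value independent of `i`. -/
theorem AssocFin.window {n : ℕ} {f : (Fin n → X) → X} (hf : AssocFin f) (w : ℕ → X) {i j : ℕ}
    (hi : i < n) (hj : j < n) :
    f (fun k => if k.val < i then w k else
        if k.val = i then f (fun l => w (i + l)) else w (k + (n - 1))) =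
      f (fun k => if k.val < j then w k else
        if k.val = j then f (fun l => w (j + l)) else w (k + (n - 1))) := by
  have hstr : ∀ i < n, (List.range' 0 i).map w ++ (List.range' i n).map w ++
      (List.range' (i + n) (n - 1 - i)).map w = (List.range' 0 (2 * n - 1)).map w := by
    intro i hi
    rw [← List.map_append, ← List.map_append]
    congr 1
    have h1 := List.range'_append_1 (s := 0) (m := i) (n := n)
    have h2 := List.range'_append_1 (s := 0) (m := i + n) (n := n - 1 - i)
    simp only [Nat.zero_add] at h1 h2
    rw [h1, h2]
    congr 1
    omega
  have hval : ∀ i < n, ∀ (hy : ((List.range' i n).map w).length = n)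
      (h : ((List.range' 0 i).map w ++ [liftF f ((List.range' i n).map w) hy] ++
        (List.range' (i + n) (n - 1 - i)).map w).length = n),
      liftF f _ h = f (fun k => if k.val < i then w k else
        if k.val = i then f (fun l => w (i + l)) else w (k + (n - 1))) := by
    intro i hi hy h
    have hwin : liftF f ((List.range' i n).map w) hy = f (fun l => w (i + l)) := by
      simp [liftF]
    simp only [hwin]
    unfold liftF
    congr 1
    funext k
    have hk := k.isLt
    simp only [List.get_eq_getElem, Fin.val_cast, List.append_assoc, List.getElem_append,
      List.length_map, List.length_range', List.getElem_map, List.getElem_range',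
      List.length_singleton, List.getElem_singleton]
    by_cases h1 : k.val < i
    · simp [h1]
    · by_cases h2 : k.val = i
      · simp [h2]
      · have h3 : ¬ k.val - i < 1 := by omega
        simp only [h1, h2, h3, dite_false, if_false]
        congr 1
        omega
  have hl : ∀ i, ((List.range' i n).map w).length = n := by simp
  rw [← hval i hi (hl i) (by simp; omega), ← hval j hj (hl j) (by simp; omega)]
  exact hf _ _ _ _ _ _ (hl i) (hl j) (by simp; omega) (by simp; omega)
    ((hstr i hi).trans (hstr j hj).symm) _ _

/-- Polynomial functions are monotone modulo a prime ideal. -/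
theorem IsPolynomialFn.notMem_mono {n : ℕ} {f : (Fin n → L) → L} (hf : IsPolynomialFn f)
    {P : Order.Ideal L} (hP : P.IsPrime) {x y : Fin n → L} (hxy : ∀ i, x i ∉ P → y i ∉ P)
    (hx : f x ∉ P) : f y ∉ P := by
  obtain ⟨α, hα⟩ := hf
  rw [hα, P.finset_sup_mem_iff] at hx ⊢
  contrapose! hx
  intro I hI
  have h := hx I hI
  rw [hP.inf_mem_iff, hP.finset_inf_mem_iff] at h ⊢
  refine h.imp_right ?_
  rintro ⟨i, hi, hyi⟩
  exact ⟨i, hi, by_contra fun hxi => hxy i hxi hyi⟩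

/-- Modulo a prime ideal separating its extreme values, an associative polynomial function is
a meet, a join, or the projection onto the first or the last coordinate. -/
theorem IsPolynomialFn.mem_iff_of_assocFin {n : ℕ} {f : (Fin n → L) → L}
    (hf : IsPolynomialFn f) (hassoc : AssocFin f) {P : Order.Ideal L} (hP : P.IsPrime)
    (hfirst : 0 < n) (hlast : n - 1 < n) (hA : f (fun _ => ⊥) ∈ P) (hD : f (fun _ => ⊤) ∉ P)
    (x : Fin n → L) :
    (f (charVec {⟨0, hfirst⟩}) ∈ P → f (charVec {⟨n - 1, hlast⟩}) ∈ P →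
      (f x ∈ P ↔ ∃ i, x i ∈ P)) ∧
    (f (charVec {⟨0, hfirst⟩}) ∈ P → f (charVec {⟨n - 1, hlast⟩}) ∉ P →
      (f x ∈ P ↔ x ⟨n - 1, hlast⟩ ∈ P)) ∧
    (f (charVec {⟨0, hfirst⟩}) ∉ P → f (charVec {⟨n - 1, hlast⟩}) ∈ P →
      (f x ∈ P ↔ x ⟨0, hfirst⟩ ∈ P)) ∧
    (f (charVec {⟨0, hfirst⟩}) ∉ P → f (charVec {⟨n - 1, hlast⟩}) ∉ P →
      (f x ∈ P ↔ ∀ i, x i ∈ P)) := by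
  have hbot : ⊥ ∈ P := P.bot_mem
  have htop : ⊤ ∉ P := hP.toIsProper.top_notMem
  have mono : ∀ y z : Fin n → L, (∀ i, y i ∉ P → z i ∉ P) → f y ∉ P → f z ∉ P :=
    fun y z => hf.notMem_mono hP
  have transfer : ∀ (w : ℕ → L) {i j : ℕ} (_ : i < n) (_ : j < n) (y z : Fin n → L),
      (∀ k : Fin n, y k ∉ P → (if k.val < i then w k else
        if k.val = i then f (fun l => w (i + l)) else w (k + (n - 1))) ∉ P) →
      (∀ k : Fin n, (if k.val < j then w k else
        if k.val = j then f (fun l => w (j + l)) else w (k + (n - 1))) ∉ P → z k ∉ P) →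
      f y ∉ P → f z ∉ P := by
    intro w i j hi hj y z hy hz h
    have hcontracted := mono _ _ hy h
    rw [hassoc.window w hi hj] at hcontracted
    exact mono _ _ hz hcontracted
  -- modulo `P`, `f (1, …, 1, 0) ≤ f (1, 0, …, 0)` and `f (0, 1, …, 1) ≤ f (0, …, 0, 1)`
  have hb' : f (fun i => if i.val < n - 1 then ⊤ else ⊥) ∉ P → f (charVec {⟨0, hfirst⟩}) ∉ P := by
    refine transfer (fun k => if k < n - 1 then ⊤ else ⊥) hlast hfirst _ _ ?_ ?_
    · intro i
      by_cases hi : i.val < n - 1 <;> simp [hi, hbot, htop]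
    · intro i
      by_cases hi : i.val = 0 <;> simp [charVec, Fin.ext_iff, hi, hbot, htop]
  have hc' : f (fun i => if i.val = 0 then ⊥ else ⊤) ∉ P → f (charVec {⟨n - 1, hlast⟩}) ∉ P := by
    refine transfer (fun k => if k < n then ⊥ else ⊤) hfirst hlast _ _ ?_ ?_
    · intro i
      have h1 : i.val ≠ 0 → ¬ i.val + (n - 1) < n := by omega
      by_cases hi : i.val = 0 <;> simp [hi, h1, hbot, htop]
    · intro i
      have h1 : i.val < n - 1 ∨ i.val = n - 1 := by omega
      rcases h1 with hi | hi <;> simp [charVec, Fin.ext_iff, hi, hbot, htop]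
  have hxa : (∀ i, x i ∈ P) → f x ∈ P := fun hx =>
    by_contra fun h => mono x _ (fun i hi => absurd (hx i) hi) h hA
  have hxd : (∀ i, x i ∉ P) → f x ∉ P := fun hx =>
    mono _ x (fun i _ => hx i) hD
  have hxb : f (charVec {⟨0, hfirst⟩}) ∉ P → x ⟨0, hfirst⟩ ∉ P → f x ∉ P := by
    intro h hx
    refine mono _ x ?_ h
    intro i
    by_cases hi : i = ⟨0, hfirst⟩ <;> simp [charVec, hi, hx, hbot]
  have hxc : f (charVec {⟨n - 1, hlast⟩}) ∉ P → x ⟨n - 1, hlast⟩ ∉ P → f x ∉ P := by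
    intro h hx
    refine mono _ x ?_ h
    intro i
    by_cases hi : i = ⟨n - 1, hlast⟩ <;> simp [charVec, hi, hx, hbot]
  have hxb' : f (charVec {⟨0, hfirst⟩}) ∈ P → x ⟨n - 1, hlast⟩ ∈ P → f x ∈ P := by
    intro h hx
    by_contra hfx
    refine hb' (mono x _ ?_ hfx) h
    intro i
    by_cases hi : i.val < n - 1
    · simp [hi, htop]
    · obtain rfl : i = ⟨n - 1, hlast⟩ := Fin.ext (by simp; omega)
      simp [hx]
  have hxc' : f (charVec {⟨n - 1, hlast⟩}) ∈ P → x ⟨0, hfirst⟩ ∈ P → f x ∈ P := by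
    intro h hx
    by_contra hfx
    refine hc' (mono x _ ?_ hfx) h
    intro i
    by_cases hi : i = ⟨0, hfirst⟩
    · simp [hi, hx]
    · have : i.val ≠ 0 := fun h => hi (Fin.ext h)
      simp [this, htop]
  have hor : f (charVec {⟨0, hfirst⟩}) ∉ P → f (charVec {⟨n - 1, hlast⟩}) ∉ P →
      (∃ i, x i ∉ P) → f x ∉ P := by
    rintro hB hC ⟨p, hp⟩ hfx
    have hwin : f (fun l => if n - 1 - p.val + l.val = n - 1 then ⊤ else ⊥) ∈ P := by
      by_contra h
      refine mono _ x ?_ h hfx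
      intro i
      by_cases hi : i = p
      · simp [hi, hp]
      · have : ¬ n - 1 - p.val + i.val = n - 1 := fun h => hi (Fin.ext (by omega))
        simp [this, hbot]
    have hbwin : f (fun l => if n - 1 + l.val = n - 1 then ⊤ else ⊥) ∉ P := by
      refine mono _ _ ?_ hB
      intro i
      by_cases hi : i.val = 0 <;> simp [charVec, Fin.ext_iff, hi, hbot, htop]
    refine transfer (fun k => if k = n - 1 then ⊤ else ⊥) hlast
      (show n - 1 - p.val < n by omega) _ (fun _ => ⊥) ?_ ?_ hC hA
    · intro i
      by_cases hi : i.val = n - 1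
      · simp only [hi, lt_irrefl, if_false, if_true]
        exact fun _ => hbwin
      · simp [charVec, Fin.ext_iff, hi, hbot]
    · intro i
      split_ifs
      all_goals first | omega | simp [hbot, hwin]
  have hand : f (charVec {⟨0, hfirst⟩}) ∈ P → f (charVec {⟨n - 1, hlast⟩}) ∈ P →
      (∃ i, x i ∈ P) → f x ∈ P := by
    rintro hB hC ⟨p, hp⟩
    by_contra hfx
    have hwin : f (fun l => if n - 1 - p.val + l.val = n - 1 then ⊥ else ⊤) ∉ P := by
      refine mono x _ ?_ hfx
      intro i
      by_cases hi : i = p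
      · simp [hi, hp]
      · have : ¬ n - 1 - p.val + i.val = n - 1 := fun h => hi (Fin.ext (by omega))
        simp [this, htop]
    have hcwin : f (fun l => if n - 1 + l.val = n - 1 then ⊥ else ⊤) ∈ P := by
      by_contra h
      refine hc' (mono _ _ ?_ h) hC
      intro i
      by_cases hi : i.val = 0 <;> simp [hi, htop]
    refine hb' (transfer (fun k => if k = n - 1 then ⊥ else ⊤)
      (show n - 1 - p.val < n by omega) hlast (fun _ => ⊤) _ ?_ ?_ hD) hB
    · intro i
      split_ifs
      all_goals first | omega | simp [htop, hwin]
    · intro i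
      by_cases hi : i.val < n - 1
      · simp [hi, htop]
      · have hi' : i.val = n - 1 := by omega
        simp only [hi', lt_irrefl, if_false, if_true]
        exact fun h => absurd hcwin h
  refine ⟨fun hB hC => ⟨fun h => ?_, hand hB hC⟩,
    fun hB hC => ⟨fun h => by_contra fun hx => hxc hC hx h, hxb' hB⟩,
    fun hB hC => ⟨fun h => by_contra fun hx => hxb hB hx h, hxc' hC⟩,
    fun hB hC => ⟨fun h => ?_, hxa⟩⟩
  · by_contra hx
    exact hxd (not_exists.1 hx) h
  · by_contra hx
    exact hor hB hC (not_forall.1 hx) h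

/-- an associative lattice polynomial function `f : Lⁿ → L` can be written
as `f(x) = med(a, (b ∧ x₁) ∨ med(⋀ᵢ xᵢ, b ∧ c, ⋁ᵢ xᵢ) ∨ (c ∧ xₙ), d)`. -/
theorem stmt11 {n : ℕ} (hn : 1 ≤ n) (f : (Fin n → L) → L)
    (hf : IsPolynomialFn f) (hassoc : AssocFin f)
    (a b c d : L)
    (ha : a = f fun _ => ⊥)
    (hb : b = f (charVec {(⟨0, by omega⟩ : Fin n)}))
    (hc : c = f (charVec {(⟨n - 1, by omega⟩ : Fin n)}))
    (hd : d = f fun _ => ⊤)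
    (x : Fin n → L) :
    f x = med a
      ((b ⊓ x ⟨0, by omega⟩) ⊔ med (Finset.univ.inf x) (b ⊓ c) (Finset.univ.sup x) ⊔
        (c ⊓ x ⟨n - 1, by omega⟩)) d := by
  apply DistribLattice.eq_of_forall_isPrime_mem_iff
  intro P hP
  have hfirst : 0 < n := hn
  have hlast : n - 1 < n := by omega
  simp only [med, hP.inf_mem_iff, Order.Ideal.sup_mem_iff, hP.finset_inf_mem_iff,
    P.finset_sup_mem_iff, Finset.mem_univ, true_and, true_imp_iff]
  by_cases hA : a ∉ P
  · have hfx : f x ∉ P := hf.notMem_mono hP (fun _ h => absurd P.bot_mem h) (ha ▸ hA)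
    have hdP : d ∉ P :=
      hd ▸ hf.notMem_mono hP (fun _ _ => hP.toIsProper.top_notMem) hfx
    tauto
  by_cases hD : d ∈ P
  · have hfx : f x ∈ P := by_contra fun h =>
      (hd ▸ hf.notMem_mono hP (fun _ _ => hP.toIsProper.top_notMem) h) hD
    tauto
  rw [not_not] at hA
  have hfst : x ⟨0, hfirst⟩ ∈ P → ∃ i, x i ∈ P := fun h => ⟨_, h⟩
  have hlst : x ⟨n - 1, hlast⟩ ∈ P → ∃ i, x i ∈ P := fun h => ⟨_, h⟩
  obtain ⟨h1, h2, h3, h4⟩ :=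
    hf.mem_iff_of_assocFin hassoc hP hfirst hlast (ha ▸ hA) (hd ▸ hD) x
  rw [← hb, ← hc] at h1 h2 h3 h4
  by_cases hB : b ∈ P <;> by_cases hC : c ∈ P <;>
    simp only [hA, hD, hB, hC, true_and, and_true, true_or, or_true, false_or, or_false,
      and_false, false_and, or_self]
  · rw [h1 hB hC]
    grind
  · rw [h2 hB hC]
    grind
  · rw [h3 hB hC]
    grind
  · rw [h4 hB hC]
    grind
end

section
/- Let L be a bounded distributive lattice and let f : L^n → L be a lattice polynomial function. Then f is associative (as an n-ary function) if and only if there exists an associative polynomial function g : L* → L such that g_n = f. -/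
variable {X : Type*}

variable {L : Type*} [DistribLattice L] [BoundedOrder L]

theorem le_of_forall_boundedLatticeHom_prop {u v : L}
    (h : ∀ φ : BoundedLatticeHom L Prop, φ u → φ v) : u ≤ v := by
  by_contra huv
  have hd : Disjoint (Order.PFilter.principal u : Set L) (Order.Ideal.principal v : Set L) := by
    rw [Set.disjoint_left]
    intro x hx hx'
    exact huv ((Order.PFilter.mem_principal.1 hx).trans (Order.Ideal.mem_principal.1 hx'))
  obtain ⟨J, hJ, hvJ, huJ⟩ := DistribLattice.prime_ideal_of_disjoint_filter_ideal hd
  let φ : BoundedLatticeHom L Prop :=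
    { toFun := fun x => x ∉ J
      map_sup' := fun x y => by
        simp only [Order.Ideal.sup_mem_iff, sup_Prop_eq, eq_iff_iff]; tauto
      map_inf' := fun x y => by
        have h₁ : x ⊓ y ∈ J → x ∈ J ∨ y ∈ J := fun hxy => hJ.mem_or_mem hxy
        have h₂ : x ∈ J → x ⊓ y ∈ J := fun hx => J.lower inf_le_left hx
        have h₃ : y ∈ J → x ⊓ y ∈ J := fun hy => J.lower inf_le_right hy
        simp only [inf_Prop_eq, eq_iff_iff]; tauto
      map_top' := by
        simp [hJ.toIsProper.top_notMem]
      map_bot' := by simp }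
  exact h φ (Set.disjoint_left.1 huJ (Order.PFilter.mem_principal.2 le_rfl))
    (hvJ (Order.Ideal.mem_principal.2 le_rfl))

theorem eq_of_forall_boundedLatticeHom_prop {u v : L}
    (h : ∀ φ : BoundedLatticeHom L Prop, φ u ↔ φ v) : u = v :=
  le_antisymm (le_of_forall_boundedLatticeHom_prop fun φ => (h φ).1)
    (le_of_forall_boundedLatticeHom_prop fun φ => (h φ).2)

theorem boundedLatticeHom_prop_dnf {n : ℕ} (φ : BoundedLatticeHom L Prop)
    (α : Finset (Fin n) → L) (x : Fin n → L) :
    φ (Finset.univ.sup fun I : Finset (Fin n) => α I ⊓ I.inf x) ↔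
      ∃ I, φ (α I) ∧ ∀ i ∈ I, φ (x i) := by
  have hsup : ∀ (s : Finset (Finset (Fin n))) (p : Finset (Fin n) → L),
      φ (s.sup p) ↔ ∃ I ∈ s, φ (p I) := by
    intro s p
    induction s using Finset.induction_on with
    | empty => simp
    | insert a s _ ih => simp [ih]
  have hinf : ∀ s : Finset (Fin n), φ (s.inf x) ↔ ∀ i ∈ s, φ (x i) := by
    intro s
    induction s using Finset.induction_on with
    | empty => simp
    | insert a s _ ih => simp [ih]
  simp [hsup, hinf]

theorem boundedLatticeHom_prop_ite {φ : BoundedLatticeHom L Prop} (p : Prop) [Decidable p] :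
    φ (if p then ⊤ else ⊥) ↔ p := by
  split_ifs with h <;> simp [h]

theorem isPolynomialFn_iff {n : ℕ} {f : (Fin n → L) → L} :
    IsPolynomialFn f ↔ ∀ (φ : BoundedLatticeHom L Prop) (x y : Fin n → L),
      (∀ i, φ (x i) → φ (y i)) → φ (f x) → φ (f y) := by
  classical
  constructor
  · rintro ⟨α, hα⟩ φ x y hxy
    rw [hα, hα, boundedLatticeHom_prop_dnf, boundedLatticeHom_prop_dnf]
    exact fun ⟨I, hI, hx⟩ => ⟨I, hI, fun i hi => hxy i (hx i hi)⟩
  · intro h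
    refine ⟨fun I => f (charVec I), fun x => eq_of_forall_boundedLatticeHom_prop fun φ => ?_⟩
    rw [boundedLatticeHom_prop_dnf]
    constructor
    · intro hx
      refine ⟨Finset.univ.filter fun i => φ (x i), h φ x _ (fun i hi => ?_) hx, by simp⟩
      simp [charVec, hi]
    · rintro ⟨I, hI, hx⟩
      exact h φ _ x (fun i hi => hx i ((boundedLatticeHom_prop_ite _).1 hi)) hI

/-- The polynomial function `a ∨ (b ∧ x₁) ∨ (c ∧ xₙ) ∨ (b ∧ c ∧ ⋁ xᵢ) ∨ (d ∧ ⋀ xᵢ)` on strings. -/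
def endsPoly (a b c d : L) (l : List L) : L :=
  a ⊔ (b ⊓ l.head?.getD ⊥) ⊔ (c ⊓ l.getLast?.getD ⊥) ⊔ (b ⊓ c ⊓ l.foldr (· ⊔ ·) ⊥) ⊔
    (d ⊓ l.foldr (· ⊓ ·) ⊤)

theorem map_endsPoly {M : Type*} [DistribLattice M] [BoundedOrder M] (φ : BoundedLatticeHom L M)
    (a b c d : L) (l : List L) :
    φ (endsPoly a b c d l) = endsPoly (φ a) (φ b) (φ c) (φ d) (l.map φ) := by
  have hsup : φ (l.foldr (· ⊔ ·) ⊥) = (l.map φ).foldr (· ⊔ ·) ⊥ := by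
    induction l with
    | nil => simp
    | cons p l ih => simp [ih]
  have hinf : φ (l.foldr (· ⊓ ·) ⊤) = (l.map φ).foldr (· ⊓ ·) ⊤ := by
    clear hsup
    induction l with
    | nil => simp
    | cons p l ih => simp [ih]
  have hopt : ∀ o : Option L, φ (o.getD ⊥) = (o.map φ).getD ⊥ := by
    rintro (_ | _) <;> simp
  simp only [endsPoly, map_sup, map_inf, hsup, hinf, hopt, List.head?_map, List.getLast?_map]

theorem endsPoly_prop {a b c d : Prop} {l : List Prop} :
    endsPoly a b c d l ↔ a ∨ (b ∧ l.head?.getD False) ∨ (c ∧ l.getLast?.getD False) ∨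
      (b ∧ c ∧ ∃ p ∈ l, p) ∨ (d ∧ ∀ p ∈ l, p) := by
  have hsup : (l.foldr (· ⊔ ·) ⊥ : Prop) ↔ ∃ p ∈ l, p := by
    induction l with
    | nil => simp
    | cons p l ih =>
      rw [List.foldr_cons, propext ih]
      simp only [sup_Prop_eq, List.mem_cons, exists_eq_or_imp]
  have hinf : (l.foldr (· ⊓ ·) ⊤ : Prop) ↔ ∀ p ∈ l, p := by
    clear hsup
    induction l with
    | nil => simp
    | cons p l ih =>
      rw [List.foldr_cons, propext ih]
      simp only [inf_Prop_eq, List.mem_cons, forall_eq_or_imp]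
  rw [endsPoly, propext hsup, propext hinf]
  simp only [sup_Prop_eq, inf_Prop_eq, Prop.bot_eq_false, or_assoc, and_assoc]

theorem endsPoly_prop_append {a b c d : Prop} (hbd : b → d) (hcd : c → d) {x y z : List Prop} (hy : y ≠ []) :
    endsPoly a b c d (x ++ [endsPoly a b c d y] ++ z) ↔ endsPoly a b c d (x ++ y ++ z) := by
  have key : ∀ l : List Prop, l ≠ [] →
      ((∀ p ∈ l, p) → l.head?.getD False) ∧ ((∀ p ∈ l, p) → l.getLast?.getD False) ∧
      (l.head?.getD False → ∃ p ∈ l, p) ∧ (l.getLast?.getD False → ∃ p ∈ l, p) := by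
    intro l hl
    rw [List.head?_eq_some_head hl, List.getLast?_eq_some_getLast hl]
    exact ⟨fun h => h _ (List.head_mem hl), fun h => h _ (List.getLast_mem hl),
      fun h => ⟨_, List.head_mem hl, h⟩, fun h => ⟨_, List.getLast_mem hl, h⟩⟩
  have ky := key y hy
  have hhead : ∀ u v : List Prop, u ≠ [] →
      (u ++ v).head?.getD False = u.head?.getD False := by
    intro u v hu
    rw [List.head?_append_of_ne_nil _ hu]
  have hlast : ∀ u v : List Prop, v ≠ [] →
      (u ++ v).getLast?.getD False = v.getLast?.getD False := by
    intro u v hv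
    rw [List.getLast?_append_of_ne_nil _ hv]
  have hall : ∀ u v : List Prop, (∀ p ∈ u ++ v, p) ↔ (∀ p ∈ u, p) ∧ ∀ p ∈ v, p := by
    intro u v; simp only [List.mem_append, or_imp, forall_and]
  have hex : ∀ u v : List Prop, (∃ p ∈ u ++ v, p) ↔ (∃ p ∈ u, p) ∨ ∃ p ∈ v, p := by
    intro u v; simp only [List.mem_append, or_and_right, exists_or]
  have hy' := @endsPoly_prop a b c d y
  generalize endsPoly a b c d y = e at hy'
  rw [endsPoly_prop, endsPoly_prop]
  have he : (∀ p ∈ [e], p) ↔ e := by simp only [List.mem_singleton, forall_eq]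
  have he' : (∃ p ∈ [e], p) ↔ e := by simp only [List.mem_singleton, exists_eq_left]
  have e₁ : [e].head?.getD False = e := rfl
  have e₂ : [e].getLast?.getD False = e := rfl
  have e₃ : [e] ≠ [] := by simp
  by_cases hx : x = [] <;> by_cases hz : z = []
  · subst hx hz
    simp only [List.nil_append, List.append_nil, he, he', e₁, e₂]
    generalize (y.head?.getD False) = p at *
    generalize (y.getLast?.getD False) = q at *
    generalize (∃ p ∈ y, p) = r at *
    generalize (∀ p ∈ y, p) = s at *
    clear hhead hlast hall hex key
    grind
  · subst hx
    have kz := key z hz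
    simp only [List.nil_append, hhead _ z e₃, hhead _ z hy, hlast _ z hz, hall, hex, he, he',
      e₁]
    generalize (y.head?.getD False) = p at *
    generalize (y.getLast?.getD False) = q at *
    generalize (∃ p ∈ y, p) = r at *
    generalize (∀ p ∈ y, p) = s at *
    generalize (z.head?.getD False) = p' at *
    generalize (z.getLast?.getD False) = q' at *
    generalize (∃ p ∈ z, p) = r' at *
    generalize (∀ p ∈ z, p) = s' at *
    clear hhead hlast hall hex key
    grind
  · subst hz
    have kx := key x hx
    simp only [List.append_nil, hhead x _ hx, hlast _ _ e₃, hlast _ _ hy, hall, hex, he, he',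
      e₂]
    generalize (y.head?.getD False) = p at *
    generalize (y.getLast?.getD False) = q at *
    generalize (∃ p ∈ y, p) = r at *
    generalize (∀ p ∈ y, p) = s at *
    generalize (x.head?.getD False) = p' at *
    generalize (x.getLast?.getD False) = q' at *
    generalize (∃ p ∈ x, p) = r' at *
    generalize (∀ p ∈ x, p) = s' at *
    clear hhead hlast hall hex key
    grind
  · have kx := key x hx
    have kz := key z hz
    simp only [List.append_assoc, hhead x _ hx]
    simp only [← List.append_assoc, hlast _ z hz, hall, hex, he, he']
    generalize (y.head?.getD False) = p at *
    generalize (y.getLast?.getD False) = q at *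
    generalize (∃ p ∈ y, p) = r at *
    generalize (∀ p ∈ y, p) = s at *
    generalize (x.head?.getD False) = p' at *
    generalize (x.getLast?.getD False) = q' at *
    generalize (∃ p ∈ x, p) = r' at *
    generalize (∀ p ∈ x, p) = s' at *
    generalize (z.head?.getD False) = p'' at *
    generalize (z.getLast?.getD False) = q'' at *
    generalize (∃ p ∈ z, p) = r'' at *
    generalize (∀ p ∈ z, p) = s'' at *
    clear hhead hlast hall hex key
    grind

theorem endsPoly_prop_mono {a b c d : Prop} {l l' : List Prop}
    (h : List.Forall₂ (fun p q => p → q) l l') :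
    endsPoly a b c d l → endsPoly a b c d l' := by
  have hhead : l.head?.getD False → l'.head?.getD False := by
    cases h with
    | nil => exact id
    | cons h _ => exact h
  have hlast : l.getLast?.getD False → l'.getLast?.getD False := by
    rw [← List.head?_reverse, ← List.head?_reverse]
    have hr := List.rel_reverse h
    generalize l.reverse = r, l'.reverse = r' at hr ⊢
    cases hr with
    | nil => exact id
    | cons h _ => exact h
  have hex : (∃ p ∈ l, p) → ∃ p ∈ l', p := by
    clear hhead hlast
    induction h with
    | nil => exact id
    | cons h _ ih => simp only [List.mem_cons, exists_eq_or_imp]; exact Or.imp h ih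
  have hall : (∀ p ∈ l, p) → ∀ p ∈ l', p := by
    clear hhead hlast hex
    induction h with
    | nil => exact id
    | cons h _ ih => simp only [List.mem_cons, forall_eq_or_imp]; exact And.imp h ih
  rw [endsPoly_prop, endsPoly_prop]
  exact Or.imp id (Or.imp (And.imp id hhead) (Or.imp (And.imp id hlast)
    (Or.imp (And.imp id (And.imp id hex)) (And.imp id hall))))

theorem assocStar_endsPoly {a b c d : L} (hbd : b ≤ d) (hcd : c ≤ d) : AssocStar (endsPoly a b c d) := by
  have key : ∀ x y z : List L,
      endsPoly a b c d (x ++ strOf (endsPoly a b c d) y ++ z) =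
        endsPoly a b c d (x ++ y ++ z) := by
    rintro x (_ | ⟨y₀, y⟩) z
    · rfl
    · refine eq_of_forall_boundedLatticeHom_prop fun φ => ?_
      have := endsPoly_prop_append (a := φ a) (OrderHomClass.mono φ hbd) (OrderHomClass.mono φ hcd) (x := x.map φ)
        (y := (y₀ :: y).map φ) (z := z.map φ) (by simp)
      simpa only [strOf, map_endsPoly, List.map_append, List.map_cons, List.map_nil] using this
  intro x y z x' y' z' h
  rw [key, key, h]

theorem isPolyStar_endsPoly (a b c d : L) : IsPolyStar (endsPoly a b c d) := by
  intro n _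
  rw [isPolynomialFn_iff]
  intro φ x y hxy
  rw [map_endsPoly, map_endsPoly]
  apply endsPoly_prop_mono
  rw [List.map_ofFn, List.map_ofFn, List.forall₂_iff_get]
  simpa using fun i hi => hxy ⟨i, hi⟩

theorem forall₂_replicate_false (l : List Prop) :
    List.Forall₂ (fun p q => p → q) (List.replicate l.length False) l := by
  induction l <;> simp_all [List.replicate_succ]

theorem forall₂_replicate_true (l : List Prop) :
    List.Forall₂ (fun p q => p → q) l (List.replicate l.length True) := by
  induction l <;> simp_all [List.replicate_succ]

theorem forall₂_replicate_false_append (s t : List Prop) {p : Prop} (hp : p) :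
    List.Forall₂ (fun p q => p → q)
      (List.replicate s.length False ++ [True] ++ List.replicate t.length False)
      (s ++ [p] ++ t) :=
  List.rel_append (List.rel_append (forall₂_replicate_false s) (by simpa))
    (forall₂_replicate_false t)

theorem forall₂_replicate_true_append (s t : List Prop) {p : Prop} (hp : ¬p) :
    List.Forall₂ (fun p q => p → q) (s ++ [p] ++ t)
      (List.replicate s.length True ++ [False] ++ List.replicate t.length True) :=
  List.rel_append (List.rel_append (forall₂_replicate_true s) (by simpa))
    (forall₂_replicate_true t)

/-- A monotone associative function of `m + 1` truth values is a constant, a projection on an end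
coordinate, the disjunction or the conjunction. -/
theorem iff_endsPoly_of_assoc {m : ℕ} {F : List Prop → Prop}
    (hmono : ∀ l l' : List Prop, l.length = m + 1 → List.Forall₂ (fun p q => p → q) l l' →
      F l → F l')
    (hassoc : ∀ x y z x' y' z' : List Prop, y.length = m + 1 → y'.length = m + 1 →
      x.length + z.length = m → x'.length + z'.length = m → x ++ y ++ z = x' ++ y' ++ z' →
      F (x ++ [F y] ++ z) → F (x' ++ [F y'] ++ z'))
    {l : List Prop} (hl : l.length = m + 1) :
    F l ↔ endsPoly (F (List.replicate (m + 1) False)) (F (True :: List.replicate m False))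
      (F (List.replicate m False ++ [True])) (F (List.replicate (m + 1) True)) l := by
  have hge : ∀ l : List Prop, l.length = m + 1 → F (List.replicate (m + 1) False) → F l :=
    fun l hl => hmono _ _ (by simp) (hl ▸ forall₂_replicate_false l)
  have hle : ∀ l : List Prop, l.length = m + 1 → F l → F (List.replicate (m + 1) True) :=
    fun l hl => hmono _ _ hl (hl ▸ forall₂_replicate_true l)
  rw [endsPoly_prop]
  by_cases ha : F (List.replicate (m + 1) False)
  · simp only [ha, hge l hl ha, true_or]
  by_cases hd : F (List.replicate (m + 1) True)
  swap
  · have h₁ := mt (hle l hl) hd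
    have h₂ := mt (hle (True :: List.replicate m False) (by simp)) hd
    have h₃ := mt (hle (List.replicate m False ++ [True]) (by simp)) hd
    simp only [ha, hd, h₁, h₂, h₃, false_and, or_false]
  have hupper : ∀ s t : List Prop, ∀ p : Prop, s.length + t.length = m → p →
      F (List.replicate s.length False ++ [True] ++ List.replicate t.length False) →
      F (s ++ [p] ++ t) := by
    intro s t p hst hp
    exact hmono _ _ (by simp; omega) (forall₂_replicate_false_append s t hp)
  have hlower : ∀ s t : List Prop, ∀ p : Prop, s.length + t.length = m → ¬p →
      F (s ++ [p] ++ t) →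
      F (List.replicate s.length True ++ [False] ++ List.replicate t.length True) := by
    intro s t p hst hp
    exact hmono _ _ (by simp; omega) (forall₂_replicate_true_append s t hp)
  have hfalse : ∀ l, ¬F l → F l = False := fun _ => eq_false
  have htrue : ∀ l, F l → F l = True := fun _ => eq_true
  have hright : F (False :: List.replicate m True) → F (List.replicate m False ++ [True]) := by
    intro h
    have := hassoc [] (List.replicate (m + 1) False) (List.replicate m True)
      (List.replicate m False) (False :: List.replicate m True) [] (by simp) (by simp) (by simp)
      (by simp) (by simp [List.replicate_succ'])
    rw [hfalse _ ha, htrue _ h] at this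
    simpa using this (by simpa using h)
  have hleft : F (List.replicate m True ++ [False]) → F (True :: List.replicate m False) := by
    intro h
    have := hassoc (List.replicate m True) (List.replicate (m + 1) False) []
      [] (List.replicate m True ++ [False]) (List.replicate m False) (by simp) (by simp) (by simp)
      (by simp) (by simp [List.replicate_succ])
    rw [hfalse _ ha, htrue _ h] at this
    simpa using this (by simpa using h)
  have hhead : ∃ p t, l = p :: t ∧ t.length = m := by
    obtain _ | ⟨p, t⟩ := l
    · simp at hl
    · exact ⟨p, t, rfl, by simpa using hl⟩
  have hlast : ∃ s q, l = s ++ [q] ∧ s.length = m := by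
    obtain rfl | ⟨s, q, rfl⟩ := List.eq_nil_or_concat l
    · simp at hl
    · exact ⟨s, q, by simp, by simpa using hl⟩
  have hmid : ∀ p ∈ l, ∃ s t, l = s ++ [p] ++ t ∧ s.length + t.length = m := by
    intro p hp
    obtain ⟨s, t, rfl⟩ := List.append_of_mem hp
    refine ⟨s, t, by simp, ?_⟩
    simp at hl
    omega
  have hall : (∀ p ∈ l, p) → F l := by
    intro h
    have : l = List.replicate (m + 1) True :=
      List.eq_replicate_iff.2 ⟨hl, fun p hp => eq_true (h p hp)⟩
    rwa [this]
  have hsome : F l → ∃ p ∈ l, p := by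
    intro h
    by_contra! hn
    have : l = List.replicate (m + 1) False :=
      List.eq_replicate_iff.2 ⟨hl, fun p hp => eq_false (hn p hp)⟩
    rw [this] at h
    exact ha h
  by_cases hb : F (True :: List.replicate m False) <;>
    by_cases hc : F (List.replicate m False ++ [True]) <;>
    simp only [ha, hb, hc, hd, true_and, false_and, false_or]
  · have hor : (∃ p ∈ l, p) → F l := by
      rintro ⟨p, hp, hp'⟩
      obtain ⟨s, t, rfl, hst⟩ := hmid p hp
      refine hupper s t p hst hp' ?_
      have := hassoc [] (List.replicate m False ++ [True]) (List.replicate m False)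
        (List.replicate s.length False)
        (List.replicate t.length False ++ [True] ++ List.replicate s.length False)
        (List.replicate t.length False) (by simp) (by simp; omega) (by simp)
        (by simpa using hst) (by
          simp only [List.nil_append, List.append_assoc, ← hst]
          rw [List.replicate_add, List.append_assoc])
      rw [htrue _ hc] at this
      have h := this (by simpa using hb)
      by_cases hF : F (List.replicate t.length False ++ [True] ++ List.replicate s.length False)
      · rwa [htrue _ hF] at h
      · rw [hfalse _ hF] at h
        refine absurd ?_ ha
        rw [show m + 1 = s.length + 1 + t.length by omega, List.replicate_add,
          List.replicate_succ']
        exact h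
    obtain ⟨p, t, rfl, ht⟩ := hhead
    refine ⟨fun h => Or.inr (Or.inr (Or.inl (hsome h))), ?_⟩
    rintro (h | h | h | h)
    · exact hor ⟨p, by simp, by simpa using h⟩
    · obtain ⟨s, q, hs, -⟩ := hlast
      rw [hs] at h
      exact hor ⟨q, by simp [hs], by simpa using h⟩
    · exact hor h
    · exact hall h
  · obtain ⟨p, t, rfl, ht⟩ := hhead
    subst ht
    constructor
    · intro h
      by_contra hp
      have := hlower [] t p (by simp) (fun hp' => hp (Or.inl (by simpa using hp')))
        (by simpa using h)
      exact hc (hright (by simpa using this))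
    · rintro (h | h)
      · simpa using hupper [] t p (by simp) (by simpa using h) (by simpa using hb)
      · exact hall h
  · obtain ⟨s, q, rfl, hs⟩ := hlast
    subst hs
    constructor
    · intro h
      by_contra hp
      have := hlower s [] q (by simp) (fun hp' => hp (Or.inl (by simpa using hp')))
        (by simpa using h)
      exact hb (hleft (by simpa using this))
    · rintro (h | h)
      · simpa using hupper s [] q (by simp) (by simpa using h) (by simpa using hc)
      · exact hall h
  · refine ⟨fun h p hp => ?_, hall⟩
    by_contra hp'
    obtain ⟨s, t, rfl, hst⟩ := hmid p hp
    have hu := hlower s t p hst hp' h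
    have := hassoc (List.replicate t.length True)
      (List.replicate s.length True ++ [False] ++ List.replicate t.length True)
      (List.replicate s.length True) [] (List.replicate m True ++ [False])
      (List.replicate m True) (by simp; omega) (by simp) (by simp; omega) (by simp) (by
        rw [← hst, add_comm s.length t.length, List.replicate_add]
        simp only [List.nil_append, List.append_assoc])
    rw [htrue _ hu, hfalse _ (mt hleft hb)] at this
    rw [show m + 1 = t.length + 1 + s.length by omega, List.replicate_add,
      List.replicate_succ'] at hd
    exact hc (hright (by simpa using this hd))

theorem eq_liftF {n : ℕ} {f : (Fin n → X) → X} {g : List X → X}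
    (hg : ∀ x : Fin n → X, g (List.ofFn x) = f x) (l : List X) (h : l.length = n) :
    g l = liftF f l h := by
  subst h
  have := hg l.get
  rwa [List.ofFn_get] at this

theorem assocFin_of_assocStar {n : ℕ} (hn : 1 ≤ n) {f : (Fin n → X) → X} {g : List X → X}
    (hg : AssocStar g) (hgf : ∀ x : Fin n → X, g (List.ofFn x) = f x) : AssocFin f := by
  intro x z x' z' y y' hy hy' _ _ he h h'
  have hstr : ∀ (y : List X) (hy : y.length = n), strOf g y = [liftF f y hy] := by
    rintro (_ | ⟨p, t⟩) hy
    · simp at hy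
      omega
    · simp only [strOf, eq_liftF hgf _ hy]
  have := hg x y z x' y' z' he
  rw [hstr y hy, hstr y' hy'] at this
  rwa [← eq_liftF hgf _ h, ← eq_liftF hgf _ h']

theorem exists_list_extension {n : ℕ} [Nonempty X] (f : (Fin n → X) → X) :
    ∃ G : List X → X, ∀ x : Fin n → X, G (List.ofFn x) = f x := by
  classical
  refine ⟨fun l => if h : l.length = n then liftF f l h else Classical.arbitrary X, fun x => ?_⟩
  simp [liftF]

theorem eq_endsPoly_of_assocFin {m : ℕ} {f : (Fin (m + 1) → L) → L} (hf : IsPolynomialFn f)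
    (hassoc : AssocFin f) {G : List L → L} (hG : ∀ x : Fin (m + 1) → L, G (List.ofFn x) = f x)
    {l : List L} (hl : l.length = m + 1) :
    G l = endsPoly (G (List.replicate (m + 1) ⊥)) (G (⊤ :: List.replicate m ⊥))
      (G (List.replicate m ⊥ ++ [⊤])) (G (List.replicate (m + 1) ⊤)) l := by
  classical
  refine eq_of_forall_boundedLatticeHom_prop fun φ => ?_
  have hmono : ∀ l l' : List L, l.length = m + 1 →
      List.Forall₂ (fun p q => φ p → φ q) l l' → φ (G l) → φ (G l') := by
    intro l l' hl hll'
    rw [eq_liftF hG l hl, eq_liftF hG l' (hll'.length_eq ▸ hl)]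
    exact isPolynomialFn_iff.1 hf φ _ _ fun i => hll'.get _ _
  set ι : Prop → L := fun p => if p then ⊤ else ⊥ with hι
  have hφι : ∀ p, φ (ι p) = p := fun p => propext (boundedLatticeHom_prop_ite p)
  have hcongr : ∀ l l' : List L, l.length = m + 1 → l.map φ = l'.map φ →
      φ (G l) = φ (G l') := by
    have h : ∀ l l' : List L, l.map φ = l'.map φ →
        List.Forall₂ (fun p q => φ p → φ q) l l' := by
      intro l l' h
      rw [← List.forall₂_eq_eq_eq, List.forall₂_map_left_iff, List.forall₂_map_right_iff] at h
      exact h.imp fun _ _ hpq => hpq ▸ id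
    intro l l' hl hll'
    have hl' : l'.length = m + 1 := by
      rw [← hl]; simpa using (congrArg List.length hll').symm
    exact propext ⟨hmono l l' hl (h _ _ hll'), hmono l' l hl' (h _ _ hll'.symm)⟩
  set F : List Prop → Prop := fun l => φ (G (l.map ι)) with hF
  have hGF : ∀ l : List L, l.length = m + 1 → φ (G l) = F (l.map φ) := fun l hl =>
    hcongr _ _ hl (by simp [Function.comp_def, hφι])
  have main := iff_endsPoly_of_assoc (m := m) (F := F) ?_ ?_ (l := l.map φ) (by simpa)
  · rw [map_endsPoly, hGF l hl, hGF _ (by simp), hGF _ (by simp), hGF _ (by simp),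
      hGF _ (by simp)]
    simpa using main
  · intro l l' hl hll'
    refine hmono _ _ (by simpa) ?_
    rw [List.forall₂_map_left_iff, List.forall₂_map_right_iff]
    simpa only [hφι] using hll'
  · intro x y z x' y' z' hy hy' hxz hxz' he h
    have hstep : ∀ x y z : List Prop, y.length = m + 1 → x.length + z.length = m →
        F (x ++ [F y] ++ z) = φ (G (x.map ι ++ [G (y.map ι)] ++ z.map ι)) := by
      intro x y z _ hxz
      refine hcongr _ _ (by simp; omega) ?_
      simp [Function.comp_def, hφι, hF]
    rw [hstep _ _ _ hy hxz] at h
    rw [hstep _ _ _ hy' hxz']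
    have := hassoc (x.map ι) (z.map ι) (x'.map ι) (z'.map ι) (y.map ι) (y'.map ι) (by simpa)
      (by simpa) (by simpa) (by simpa) (by simpa using congrArg (List.map ι) he)
      (by simp; omega) (by simp; omega)
    simp only [← eq_liftF hG] at this
    rwa [← this]

/-- a lattice polynomial function `f : Lⁿ → L` is associative if and only
if it is the `n`-ary component of some associative polynomial function `g : L* → L`. -/
theorem stmt15 {n : ℕ} (hn : 1 ≤ n) (f : (Fin n → L) → L) (hf : IsPolynomialFn f) :
    AssocFin f ↔ ∃ g : List L → L, AssocStar g ∧ IsPolyStar g ∧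
      ∀ x : Fin n → L, g (List.ofFn x) = f x := by
  refine ⟨fun h => ?_, fun ⟨g, hg, _, hgf⟩ => assocFin_of_assocStar hn hg hgf⟩
  obtain ⟨m, rfl⟩ : ∃ m, n = m + 1 := ⟨n - 1, by omega⟩
  have : Nonempty L := ⟨⊥⟩
  obtain ⟨G, hG⟩ := exists_list_extension f
  have hmono : ∀ l l' : List L, l.length = m + 1 → List.Forall₂ (· ≤ ·) l l' → G l ≤ G l' := by
    intro l l' hl hll'
    refine le_of_forall_boundedLatticeHom_prop fun φ => ?_
    rw [eq_liftF hG l hl, eq_liftF hG l' (hll'.length_eq ▸ hl)]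
    exact isPolynomialFn_iff.1 hf φ _ _ fun i => OrderHomClass.mono φ (hll'.get _ _)
  have htop : ∀ l : List L, l.length = m + 1 → G l ≤ G (List.replicate (m + 1) ⊤) := by
    intro l hl
    refine hmono _ _ hl ?_
    rw [List.forall₂_iff_get]
    simp [hl]
  refine ⟨_, assocStar_endsPoly (a := G (List.replicate (m + 1) ⊥)) (htop (⊤ :: List.replicate m ⊥) ?_)
    (htop (List.replicate m ⊥ ++ [⊤]) ?_), isPolyStar_endsPoly _ _ _ _, fun x => ?_⟩
  iterate 2 simp
  rw [← hG, ← eq_endsPoly_of_assocFin hf h hG (by simp)]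
end
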